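/- Define D_n = Σ_{j∈ℤ} (−1)^j q^{j(5j−3)/2} [2n+1 choose n+1−2j]_q. Then for all n ≥ 2, D_n − (1 + q − q^n + q^{2n}) D_{n−1} + q(1 − q^{n−1}) D_{n−2} = 0. -/

import Mathlib

open LaurentPolynomial

/-- The Gaussian (q-)binomial coefficient `[n choose k]_q`, as a Laurent polynomial in `q`,
with the convention that it vanishes for `k < 0` or `k > n`.  Defined via the standard
Pascal-type recurrence `[n+1, k] = q^k [n, k] + [n, k-1]`. -/
noncomputable def qb : ℕ → ℤ → LaurentPolynomial ℤ
  | 0, k => if k = 0 then 1 else 0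
  | (n+1), k => T k * qb n k + qb n (k-1)

/-- The variable `q`. -/
noncomputable def q : LaurentPolynomial ℤ := T 1

/-- `D n = Σ_{j∈ℤ} (−1)^j q^{j(5j−3)/2} [2n+1 choose n+1−2j]_q`. -/
noncomputable def D (n : ℕ) : LaurentPolynomial ℤ :=
  ∑ᶠ j : ℤ, (-1 : LaurentPolynomial ℤ) ^ j.natAbs * T (j * (5 * j - 3) / 2) *
    qb (2 * n + 1) ((n : ℤ) + 1 - 2 * j)

section QFactorial

variable {K : Type*} [Field K]

/-- The `q`-factorial `(x; x)_m = ∏_{i=1}^m (1 - x^i)`. -/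
def qPoch (x : K) (m : ℕ) : K := ∏ i ∈ Finset.range m, (1 - x ^ (i + 1))

/-- The reciprocal `1 / (x; x)_k`, extended by zero to negative `k`. -/
def qPochInv (x : K) (k : ℤ) : K := if 0 ≤ k then (qPoch x k.toNat)⁻¹ else 0

theorem qPoch_succ (x : K) (m : ℕ) : qPoch x (m + 1) = qPoch x m * (1 - x ^ (m + 1)) :=
  Finset.prod_range_succ _ _

theorem qPochInv_of_neg (x : K) {k : ℤ} (hk : k < 0) : qPochInv x k = 0 :=
  if_neg (not_le.mpr hk)

theorem qPochInv_zero (x : K) : qPochInv x 0 = 1 := by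
  simp [qPochInv, qPoch]

theorem qPochInv_sub_one {x : K} (hx : ∀ k : ℕ, x ^ (k + 1) ≠ 1) (k : ℤ) :
    qPochInv x (k - 1) = (1 - x ^ k) * qPochInv x k := by
  rcases lt_trichotomy k 0 with hk | rfl | hk
  · rw [qPochInv_of_neg x hk, qPochInv_of_neg x (by lia), mul_zero]
  · rw [qPochInv_of_neg x (by lia)]
    simp
  · obtain ⟨m, rfl⟩ : ∃ m : ℕ, k = m + 1 := ⟨(k - 1).toNat, by lia⟩
    have h1 : (1 - x ^ (m + 1) : K) ≠ 0 := sub_ne_zero.mpr (hx m).symm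
    have h2 : ((m : ℤ) + 1).toNat = m + 1 := by lia
    have h3 : x ^ ((m : ℤ) + 1) = x ^ (m + 1) := by exact_mod_cast zpow_natCast x (m + 1)
    rw [add_sub_cancel_right, qPochInv, qPochInv, if_pos (by lia), if_pos (by lia), h2, h3,
      Int.toNat_natCast, qPoch_succ, mul_inv, mul_left_comm, mul_inv_cancel₀ h1, mul_one]

theorem map_qb_eq (φ : LaurentPolynomial ℤ →+* K) {x : K} (hx0 : x ≠ 0)
    (hx : ∀ k : ℕ, x ^ (k + 1) ≠ 1) (hT : ∀ k : ℤ, φ (T k) = x ^ k) (m : ℕ) (k : ℤ) :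
    φ (qb m k) = qPoch x m * qPochInv x k * qPochInv x (m - k) := by
  induction m generalizing k with
  | zero =>
    rcases lt_trichotomy k 0 with hk | rfl | hk
    · simp [qb, hk.ne, qPochInv_of_neg x hk]
    · simp [qb, qPochInv_zero, qPoch]
    · simp [qb, hk.ne', qPochInv_of_neg x (neg_lt_zero.mpr hk)]
  | succ m ih =>
    have h1 : qPochInv x ((m : ℤ) - k) = (1 - x ^ ((m : ℤ) + 1 - k)) *
        qPochInv x ((m : ℤ) + 1 - k) := by
      rw [← qPochInv_sub_one hx]
      congr 1
      ring
    have h2 : (m : ℤ) - (k - 1) = m + 1 - k := by ring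
    have h3 : x ^ k * x ^ ((m : ℤ) + 1 - k) = x ^ (m + 1) := by
      rw [← zpow_add₀ hx0, add_sub_cancel]
      exact_mod_cast zpow_natCast x (m + 1)
    rw [qb, map_add, map_mul, hT, ih, ih, h1, h2, qPochInv_sub_one hx, qPoch_succ]
    push_cast
    linear_combination (-qPoch x m * qPochInv x k * qPochInv x ((m : ℤ) + 1 - k)) * h3

/-- The sign and power of `x` in the `j`-th summand of `D`. -/
def thetaWeight (x : K) (j : ℤ) : K := (-1) ^ j.natAbs * x ^ (j * (5 * j - 3) / 2)

theorem neg_one_pow_natAbs (j : ℤ) : (-1 : K) ^ j.natAbs = (-1) ^ j := by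
  rcases Int.natAbs_eq j with h | h
  · conv_rhs => rw [h, zpow_natCast]
  · conv_rhs => rw [h, zpow_neg, zpow_natCast, ← inv_pow, inv_neg, inv_one]

theorem thetaWeight_neg {x : K} (hx0 : x ≠ 0) (j : ℤ) :
    thetaWeight x (-j) = (x ^ j) ^ 3 * thetaWeight x j := by
  have h : -j * (5 * -j - 3) / 2 = j * (5 * j - 3) / 2 + j * 3 := by
    rw [← Int.add_mul_ediv_left _ _ (by norm_num)]
    congr 1
    ring
  rw [thetaWeight, thetaWeight, Int.natAbs_neg, h, zpow_add₀ hx0, zpow_mul]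
  norm_cast
  ring

theorem thetaWeight_add_one {x : K} (hx0 : x ≠ 0) (j : ℤ) :
    thetaWeight x (j + 1) = -x * (x ^ j) ^ 5 * thetaWeight x j := by
  have h : (j + 1) * (5 * (j + 1) - 3) / 2 = j * (5 * j - 3) / 2 + (j * 5 + 1) := by
    rw [← Int.add_mul_ediv_left _ _ (by norm_num)]
    congr 1
    ring
  rw [thetaWeight, thetaWeight, neg_one_pow_natAbs, neg_one_pow_natAbs, h, zpow_add₀ hx0,
    zpow_add_one₀ hx0, zpow_mul, zpow_add_one₀ (neg_ne_zero.mpr one_ne_zero)]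
  simp only [zpow_ofNat]
  ring

/-- The `j`-th summand of `D n`, written with `q`-factorials. -/
def summand (x : K) (n : ℕ) (j : ℤ) : K :=
  thetaWeight x j * (qPoch x (2 * n + 1) * qPochInv x (n + 1 - 2 * j) * qPochInv x (n + 2 * j))

theorem finite_support_summand (x : K) (n : ℕ) : (Function.support (summand x n)).Finite := by
  refine (Set.finite_Icc (-(n : ℤ) - 1) (n + 1)).subset fun j hj => ?_
  by_contra h
  refine hj ?_
  rw [Set.mem_Icc, not_and_or] at h
  rcases h with h | h
  · rw [summand, qPochInv_of_neg x (k := n + 2 * j) (by lia), mul_zero, mul_zero]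
  · rw [summand, qPochInv_of_neg x (k := n + 1 - 2 * j) (by lia), mul_zero, zero_mul, mul_zero]

/-- The rational part of the telescoping certificate, in terms of `c = x^m` and `b = x^j`. -/
def certificatePoly (x c b : K) : K :=
  (x ^ 7 * c ^ 3 - x ^ 6 * c ^ 2) * b⁻¹ ^ 4 + (x ^ 7 * c ^ 3 - x ^ 9 * c ^ 5) * b⁻¹ ^ 3
  + (x ^ 10 * c ^ 6 - x ^ 8 * c ^ 5 + x ^ 5 * c ^ 3 - x ^ 7 * c ^ 4 - x ^ 4 * c ^ 2
    + 2 * x ^ 6 * c ^ 3 - 2 * x ^ 8 * c ^ 4 + x ^ 7 * c ^ 3) * b⁻¹ ^ 2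
  + (x ^ 6 * c ^ 4 + x ^ 10 * c ^ 6 - x ^ 4 * c ^ 2 - x ^ 8 * c ^ 4) * b⁻¹
  + (x ^ 9 * c ^ 6 - x ^ 7 * c ^ 5 + x ^ 4 * c ^ 3 - x ^ 6 * c ^ 4 - x ^ 3 * c ^ 2
    + 2 * x ^ 5 * c ^ 3 - 2 * x ^ 7 * c ^ 4 + x ^ 6 * c ^ 3)
  + (x ^ 5 * c ^ 3 - x ^ 7 * c ^ 5) * b + (x ^ 4 * c ^ 3 - x ^ 3 * c ^ 2) * b ^ 2

/-- The telescoping certificate for the symmetrized recurrence. -/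
def certificate (x : K) (m : ℕ) (j : ℤ) : K :=
  thetaWeight x j * (qPoch x (2 * m + 1) * qPochInv x (m + 3 - 2 * j) * qPochInv x (m + 1 + 2 * j))
    * certificatePoly x (x ^ m) (x ^ j)

theorem finite_support_certificate (x : K) (m : ℕ) :
    (Function.support (certificate x m)).Finite := by
  refine (Set.finite_Icc (-(m : ℤ) - 3) (m + 3)).subset fun j hj => ?_
  by_contra h
  refine hj ?_
  rw [Set.mem_Icc, not_and_or] at h
  rcases h with h | h
  · rw [certificate, qPochInv_of_neg x (k := m + 1 + 2 * j) (by lia), mul_zero, mul_zero, zero_mul]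
  · rw [certificate, qPochInv_of_neg x (k := m + 3 - 2 * j) (by lia), mul_zero, zero_mul, mul_zero,
      zero_mul]

/-- The `j`-th summand of the recurrence operator applied to `D`. -/
def recurrenceSummand (x : K) (m : ℕ) (j : ℤ) : K :=
  summand x (m + 2) j - (1 + x - x ^ (m + 2) + x ^ (2 * (m + 2))) * summand x (m + 1) j
    + x * (1 - x ^ (m + 1)) * summand x m j

/-- The `q`-factorial part of `recurrenceSummand`, relative to
`qPochInv x (m + 3 - 2 * j) * qPochInv x (m + 3 + 2 * j)`; here `c = x^m` and `b = x^j`. -/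
def recurrencePoly (x c b : K) : K :=
  (1 - x ^ 2 * c ^ 2) * (1 - x ^ 3 * c ^ 2) * (1 - x ^ 4 * c ^ 2) * (1 - x ^ 5 * c ^ 2)
      * (1 - x ^ 3 * c * b ^ 2)
  - (1 + x - x ^ 2 * c + x ^ 4 * c ^ 2) * (1 - x ^ 2 * c ^ 2) * (1 - x ^ 3 * c ^ 2)
      * (1 - x ^ 3 * c * b⁻¹ ^ 2) * (1 - x ^ 2 * c * b ^ 2) * (1 - x ^ 3 * c * b ^ 2)
  + x * (1 - x * c) * (1 - x ^ 3 * c * b⁻¹ ^ 2) * (1 - x ^ 2 * c * b⁻¹ ^ 2)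
      * (1 - x * c * b ^ 2) * (1 - x ^ 2 * c * b ^ 2) * (1 - x ^ 3 * c * b ^ 2)

theorem qPochInv_pred_add {x : K} (hx0 : x ≠ 0) (hx : ∀ k : ℕ, x ^ (k + 1) ≠ 1) (m d : ℕ)
    (j : ℤ) : qPochInv x (m + d + 2 * j) =
      (1 - x ^ (d + 1) * x ^ m * (x ^ j) ^ 2) * qPochInv x (m + (d + 1 : ℕ) + 2 * j) := by
  have h : x ^ ((m : ℤ) + (d + 1 : ℕ) + 2 * j) = x ^ (d + 1) * x ^ m * (x ^ j) ^ 2 := by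
    rw [zpow_add₀ hx0, zpow_add₀ hx0, zpow_natCast, zpow_natCast, mul_comm 2 j, zpow_mul]
    norm_cast
    ring
  rw [← h, ← qPochInv_sub_one hx]
  congr 1
  push_cast
  ring

theorem recurrenceSummand_eq {x : K} (hx0 : x ≠ 0) (hx : ∀ k : ℕ, x ^ (k + 1) ≠ 1) (m : ℕ)
    (j : ℤ) : recurrenceSummand x m j = thetaWeight x j * qPoch x (2 * m + 1)
      * (qPochInv x (m + 3 + 2 * -j) * qPochInv x (m + 3 + 2 * j))
      * recurrencePoly x (x ^ m) (x ^ j) := by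
  have e (d : ℕ) := qPochInv_pred_add hx0 hx m d j
  have f (d : ℕ) := qPochInv_pred_add hx0 hx m d (-j)
  have e0 := e 0
  have e1 := e 1
  have e2 := e 2
  have f1 := f 1
  have f2 := f 2
  simp only [zpow_neg] at f1 f2
  push_cast at e0 e1 e2 f1 f2
  norm_num only [add_zero] at e0 e1 e2 f1 f2
  have s2 : summand x (m + 2) j = thetaWeight x j * (qPoch x (2 * (m + 2) + 1) *
      qPochInv x (m + 3 + 2 * -j) * qPochInv x (m + 2 + 2 * j)) := by
    rw [summand]; push_cast; congr 4; ring
  have s1 : summand x (m + 1) j = thetaWeight x j * (qPoch x (2 * (m + 1) + 1) *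
      qPochInv x (m + 2 + 2 * -j) * qPochInv x (m + 1 + 2 * j)) := by
    rw [summand]; push_cast; congr 4; ring
  have s0 : summand x m j = thetaWeight x j * (qPoch x (2 * m + 1) *
      qPochInv x (m + 1 + 2 * -j) * qPochInv x (m + 2 * j)) := by
    rw [summand]; congr 4; ring
  have p1 : qPoch x (2 * (m + 1) + 1) = qPoch x (2 * m + 1) * (1 - x ^ 2 * (x ^ m) ^ 2)
      * (1 - x ^ 3 * (x ^ m) ^ 2) := by
    rw [show 2 * (m + 1) + 1 = 2 * m + 1 + 1 + 1 by ring, qPoch_succ, qPoch_succ]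
    ring
  have p2 : qPoch x (2 * (m + 2) + 1) = qPoch x (2 * (m + 1) + 1) * (1 - x ^ 4 * (x ^ m) ^ 2)
      * (1 - x ^ 5 * (x ^ m) ^ 2) := by
    rw [show 2 * (m + 2) + 1 = 2 * (m + 1) + 1 + 1 + 1 by ring, qPoch_succ, qPoch_succ]
    ring
  rw [recurrenceSummand, s2, s1, s0, p2, p1, e0, e1, e2, f1, f2, recurrencePoly]
  ring

theorem certificatePoly_telescopes {x b : K} (hx0 : x ≠ 0) (hb : b ≠ 0) (c : K) :
    recurrencePoly x c b + b ^ 3 * recurrencePoly x c b⁻¹ =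
      -x * b ^ 5 * (1 - x ^ 3 * c * b⁻¹ ^ 2) * (1 - x ^ 2 * c * b⁻¹ ^ 2)
          * certificatePoly x c (x * b)
        - (1 - x ^ 3 * c * b ^ 2) * (1 - x ^ 2 * c * b ^ 2) * certificatePoly x c b := by
  simp only [recurrencePoly, certificatePoly, inv_inv]
  field_simp
  ring

theorem recurrenceSummand_add_neg {x : K} (hx0 : x ≠ 0) (hx : ∀ k : ℕ, x ^ (k + 1) ≠ 1) (m : ℕ)
    (j : ℤ) : recurrenceSummand x m j + recurrenceSummand x m (-j) =
      certificate x m (j + 1) - certificate x m j := by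
  have e1 := qPochInv_pred_add hx0 hx m 1 j
  have e2 := qPochInv_pred_add hx0 hx m 2 j
  have f1 := qPochInv_pred_add hx0 hx m 1 (-j)
  have f2 := qPochInv_pred_add hx0 hx m 2 (-j)
  simp only [zpow_neg] at f1 f2
  push_cast at e1 e2 f1 f2
  have g0 : certificate x m j = thetaWeight x j * (qPoch x (2 * m + 1) *
      qPochInv x (m + 3 + 2 * -j) * qPochInv x (m + 1 + 2 * j))
      * certificatePoly x (x ^ m) (x ^ j) := by
    rw [certificate]; congr 5; ring
  have g1 : certificate x m (j + 1) = thetaWeight x (j + 1) * (qPoch x (2 * m + 1) *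
      qPochInv x (m + 1 + 2 * -j) * qPochInv x (m + 3 + 2 * j))
      * certificatePoly x (x ^ m) (x * x ^ j) := by
    rw [certificate, zpow_add_one₀ hx0, mul_comm (x ^ j) x]
    congr 4
    · congr 2; ring
    · ring
  rw [recurrenceSummand_eq hx0 hx, recurrenceSummand_eq hx0 hx, neg_neg, thetaWeight_neg hx0,
    zpow_neg, g0, g1, thetaWeight_add_one hx0, e1, e2, f1, f2]
  linear_combination (thetaWeight x j * qPoch x (2 * m + 1) * qPochInv x (m + 3 + 2 * -j)
    * qPochInv x (m + 3 + 2 * j)) *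
    certificatePoly_telescopes hx0 (zpow_ne_zero j hx0) (x ^ m)

theorem finsum_shift_sub_self {f : ℤ → K} (hf : (Function.support f).Finite) :
    ∑ᶠ j, (f (j + 1) - f j) = 0 := by
  have h : (Function.support fun j => f (j + 1)).Finite :=
    hf.preimage (add_left_injective 1).injOn
  rw [finsum_sub_distrib h hf, sub_eq_zero]
  exact finsum_comp_equiv (Equiv.addRight (1 : ℤ))

theorem finite_support_recurrenceSummand (x : K) (m : ℕ) :
    (Function.support (recurrenceSummand x m)).Finite := by
  refine (((finite_support_summand x (m + 2)).union (finite_support_summand x (m + 1))).union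
    (finite_support_summand x m)).subset fun j hj => ?_
  by_contra h
  simp only [Set.mem_union, Function.mem_support, not_or, not_not] at h
  exact hj (by simp [recurrenceSummand, h])

theorem finsum_recurrenceSummand [CharZero K] {x : K} (hx0 : x ≠ 0)
    (hx : ∀ k : ℕ, x ^ (k + 1) ≠ 1) (m : ℕ) : ∑ᶠ j, recurrenceSummand x m j = 0 := by
  have hF := finite_support_recurrenceSummand x m
  have hneg : ∑ᶠ j, recurrenceSummand x m (-j) = ∑ᶠ j, recurrenceSummand x m j :=
    finsum_comp_equiv (Equiv.neg ℤ)
  rw [← add_self_eq_zero]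
  nth_rewrite 2 [← hneg]
  rw [← finsum_add_distrib hF (hF.preimage neg_injective.injOn),
    finsum_congr (recurrenceSummand_add_neg hx0 hx m),
    finsum_shift_sub_self (finite_support_certificate x m)]

theorem finsum_summand_recurrence [CharZero K] {x : K} (hx0 : x ≠ 0)
    (hx : ∀ k : ℕ, x ^ (k + 1) ≠ 1) (m : ℕ) :
    ∑ᶠ j, summand x (m + 2) j
      - (1 + x - x ^ (m + 2) + x ^ (2 * (m + 2))) * ∑ᶠ j, summand x (m + 1) j
      + x * (1 - x ^ (m + 1)) * ∑ᶠ j, summand x m j = 0 := by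
  have h0 := finite_support_summand x m
  have h1 := finite_support_summand x (m + 1)
  have h2 := finite_support_summand x (m + 2)
  have hs (c : K) {f : ℤ → K} (hf : (Function.support f).Finite) :
      (Function.support fun j => c * f j).Finite :=
    hf.subset (Function.support_mul_subset_right _ _)
  rw [mul_finsum, mul_finsum, ← finsum_sub_distrib h2 (hs _ h1),
    ← finsum_add_distrib _ (hs _ h0)]
  · exact finsum_recurrenceSummand hx0 hx m
  · exact (h2.union (hs _ h1)).subset (Function.support_sub _ _)

theorem map_D_eq (φ : LaurentPolynomial ℤ →+* K) (hφ : Function.Injective φ) {x : K}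
    (hx0 : x ≠ 0) (hx : ∀ k : ℕ, x ^ (k + 1) ≠ 1) (hT : ∀ k : ℤ, φ (T k) = x ^ k) (n : ℕ) :
    φ (D n) = ∑ᶠ j, summand x n j := by
  rw [D]
  refine (φ.toAddMonoidHom.map_finsum_of_injective hφ _).trans (finsum_congr fun j => ?_)
  have h : ((2 * n + 1 : ℕ) : ℤ) - (n + 1 - 2 * j) = n + 2 * j := by push_cast; ring
  simp [summand, thetaWeight, map_qb_eq φ hx0 hx hT, hT, ← h]

end QFactorial

theorem map_T_eq_zpow {K : Type*} [Field K] (φ : LaurentPolynomial ℤ →+* K) (k : ℤ) :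
    φ (T k) = φ (T 1) ^ k := by
  have h (m : ℕ) : φ (T m) = φ (T 1) ^ m := by rw [← map_pow, T_pow, mul_one]
  rcases Int.natAbs_eq k with hk | hk
  · rw [hk, h, zpow_natCast]
  · rw [hk, zpow_neg, zpow_natCast, ← h]
    refine eq_inv_of_mul_eq_one_left ?_
    rw [← map_mul, ← T_add, neg_add_cancel, T_zero, map_one]

theorem T_one_pow_succ_ne_one (k : ℕ) : (T 1 : LaurentPolynomial ℤ) ^ (k + 1) ≠ 1 := by
  rw [T_pow, ← T_zero]
  intro h
  have h' := congrArg LaurentPolynomial.degree h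
  rw [LaurentPolynomial.degree_T, LaurentPolynomial.degree_T] at h'
  norm_cast at h'

theorem stmt10 (n : ℕ) (hn : 2 ≤ n) :
    D n - (1 + q - q ^ n + q ^ (2 * n)) * D (n - 1)
      + q * (1 - q ^ (n - 1)) * D (n - 2) = 0 := by
  obtain ⟨m, rfl⟩ := Nat.exists_eq_add_of_le' hn
  let φ := algebraMap (LaurentPolynomial ℤ) (FractionRing (LaurentPolynomial ℤ))
  have hφ : Function.Injective φ := IsFractionRing.injective _ _
  have : CharZero (LaurentPolynomial ℤ) :=
    charZero_of_injective_ringHom Polynomial.toLaurent_injective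
  have : CharZero (FractionRing (LaurentPolynomial ℤ)) :=
    charZero_of_injective_algebraMap hφ
  have hx0 : φ q ≠ 0 := by
    rw [Ne, map_eq_zero_iff φ hφ]
    exact (isUnit_T 1).ne_zero
  have hx (k : ℕ) : φ q ^ (k + 1) ≠ 1 := by
    rw [← map_pow, ← map_one φ]
    exact hφ.ne (T_one_pow_succ_ne_one k)
  have hD := map_D_eq φ hφ hx0 hx (map_T_eq_zpow φ)
  apply hφ
  rw [show m + 2 - 1 = m + 1 by lia, Nat.add_sub_cancel]
  simpa [hD] using finsum_summand_recurrence hx0 hx m
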